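/- Let X be a compact metric space and M > 0. The map μ ↦ μ ⊗ μ, restricted to the set of finite signed Borel measures on X with total variation at most M (with the weak-* topology) and valued in signed Borel measures on X × X of total variation at most M² (with the weak-* topology), is continuous. -/

import Mathlib

open MeasureTheory

noncomputable section

/-- Integral of a function against a finite signed measure, via the Jordan decomposition. -/
def signedIntegral {X : Type*} [MeasurableSpace X] (μ : SignedMeasure X) (f : X → ℝ) : ℝ :=
  (∫ x, f x ∂μ.toJordanDecomposition.posPart) - (∫ x, f x ∂μ.toJordanDecomposition.negPart)

/-- The weak-* topology on finite signed Borel measures: the coarsest topology making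
`μ ↦ ∫ f dμ` continuous for every continuous `f`. -/
def weakStarTopology (X : Type*) [MeasurableSpace X] [TopologicalSpace X] :
    TopologicalSpace (SignedMeasure X) :=
  TopologicalSpace.induced (fun μ : SignedMeasure X => fun f : C(X, ℝ) => signedIntegral μ f)
    Pi.topologicalSpace

/-- The product `μ ⊗ ν` of two finite signed measures, via Jordan decompositions. -/
def signedProd {X : Type*} [MeasurableSpace X] (μ ν : SignedMeasure X) :
    SignedMeasure (X × X) :=
  ((μ.toJordanDecomposition.posPart.prod ν.toJordanDecomposition.posPart
      + μ.toJordanDecomposition.negPart.prod ν.toJordanDecomposition.negPart).toSignedMeasure)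
  - ((μ.toJordanDecomposition.posPart.prod ν.toJordanDecomposition.negPart
      + μ.toJordanDecomposition.negPart.prod ν.toJordanDecomposition.posPart).toSignedMeasure)

lemma posPart_toSignedMeasure_sub_le {Y : Type*} [MeasurableSpace Y] (a b : Measure Y)
    [IsFiniteMeasure a] [IsFiniteMeasure b] :
    (a.toSignedMeasure - b.toSignedMeasure).toJordanDecomposition.posPart ≤ a := by
  rw [Measure.toJordanDecomposition_toSignedMeasure_sub]
  exact Measure.sub_le

lemma negPart_toSignedMeasure_sub_le {Y : Type*} [MeasurableSpace Y] (a b : Measure Y)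
    [IsFiniteMeasure a] [IsFiniteMeasure b] :
    (a.toSignedMeasure - b.toSignedMeasure).toJordanDecomposition.negPart ≤ b := by
  rw [Measure.toJordanDecomposition_toSignedMeasure_sub]
  exact Measure.sub_le

lemma add_negPart_toSignedMeasure_sub {Y : Type*} [MeasurableSpace Y] (a b : Measure Y)
    [IsFiniteMeasure a] [IsFiniteMeasure b] :
    a + (a.toSignedMeasure - b.toSignedMeasure).toJordanDecomposition.negPart =
      b + (a.toSignedMeasure - b.toSignedMeasure).toJordanDecomposition.posPart := by
  have h := (a.toSignedMeasure - b.toSignedMeasure).toSignedMeasure_toJordanDecomposition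
  rw [JordanDecomposition.toSignedMeasure] at h
  rw [← Measure.toSignedMeasure_eq_toSignedMeasure_iff, Measure.toSignedMeasure_add,
    Measure.toSignedMeasure_add]
  rw [sub_eq_sub_iff_add_eq_add] at h
  rw [add_comm b.toSignedMeasure, h]

lemma signedIntegral_toSignedMeasure_sub {Y : Type*} [MeasurableSpace Y] (a b : Measure Y)
    [IsFiniteMeasure a] [IsFiniteMeasure b] {f : Y → ℝ} (ha : Integrable f a)
    (hb : Integrable f b) :
    signedIntegral (a.toSignedMeasure - b.toSignedMeasure) f =
      (∫ y, f y ∂a) - ∫ y, f y ∂b := by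
  have h := congrArg (fun m => ∫ y, f y ∂m) (add_negPart_toSignedMeasure_sub a b)
  rw [integral_add_measure ha (hb.mono_measure (negPart_toSignedMeasure_sub_le a b)),
    integral_add_measure hb (ha.mono_measure (posPart_toSignedMeasure_sub_le a b))] at h
  rw [signedIntegral]
  linarith

lemma totalVariation_signedProd_le {X : Type*} [MeasurableSpace X] (μ : SignedMeasure X) :
    (signedProd μ μ).totalVariation Set.univ ≤ μ.totalVariation Set.univ ^ 2 := by
  have h := add_le_add
    (posPart_toSignedMeasure_sub_le
      (μ.toJordanDecomposition.posPart.prod μ.toJordanDecomposition.posPart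
        + μ.toJordanDecomposition.negPart.prod μ.toJordanDecomposition.negPart)
      (μ.toJordanDecomposition.posPart.prod μ.toJordanDecomposition.negPart
        + μ.toJordanDecomposition.negPart.prod μ.toJordanDecomposition.posPart) Set.univ)
    (negPart_toSignedMeasure_sub_le
      (μ.toJordanDecomposition.posPart.prod μ.toJordanDecomposition.posPart
        + μ.toJordanDecomposition.negPart.prod μ.toJordanDecomposition.negPart)
      (μ.toJordanDecomposition.posPart.prod μ.toJordanDecomposition.negPart
        + μ.toJordanDecomposition.negPart.prod μ.toJordanDecomposition.posPart) Set.univ)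
  refine h.trans_eq ?_
  simp only [SignedMeasure.totalVariation, Measure.add_apply, ← Set.univ_prod_univ,
    Measure.prod_prod]
  ring

lemma integrable_continuousMap {Y : Type*} [TopologicalSpace Y] [CompactSpace Y]
    [MeasurableSpace Y] [OpensMeasurableSpace Y] (m : Measure Y) [IsFiniteMeasure m]
    (f : C(Y, ℝ)) : Integrable f m :=
  Integrable.of_bound f.continuous.measurable.aestronglyMeasurable ‖f‖
    (Filter.Eventually.of_forall f.norm_coe_le_norm)

lemma abs_signedIntegral_le {Y : Type*} [TopologicalSpace Y] [CompactSpace Y]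
    [MeasurableSpace Y] (s : SignedMeasure Y) (f : C(Y, ℝ)) :
    |signedIntegral s f| ≤ ‖f‖ * (s.totalVariation Set.univ).toReal := by
  have hp := norm_integral_le_of_norm_le_const (μ := s.toJordanDecomposition.posPart)
    (Filter.Eventually.of_forall f.norm_coe_le_norm)
  have hn := norm_integral_le_of_norm_le_const (μ := s.toJordanDecomposition.negPart)
    (Filter.Eventually.of_forall f.norm_coe_le_norm)
  rw [SignedMeasure.totalVariation, Measure.add_apply,
    ENNReal.toReal_add (measure_ne_top _ _) (measure_ne_top _ _), mul_add]
  exact (abs_sub _ _).trans (add_le_add hp hn)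

lemma signedIntegral_add {Y : Type*} [TopologicalSpace Y] [CompactSpace Y]
    [MeasurableSpace Y] [OpensMeasurableSpace Y] (s : SignedMeasure Y) (f g : C(Y, ℝ)) :
    signedIntegral s (f + g : C(Y, ℝ)) = signedIntegral s f + signedIntegral s g := by
  simp only [signedIntegral, ContinuousMap.add_apply]
  rw [integral_add (integrable_continuousMap _ f) (integrable_continuousMap _ g),
    integral_add (integrable_continuousMap _ f) (integrable_continuousMap _ g)]
  ring

lemma signedIntegral_smul {Y : Type*} [TopologicalSpace Y]
    [MeasurableSpace Y] (s : SignedMeasure Y) (c : ℝ) (f : C(Y, ℝ)) :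
    signedIntegral s (c • f : C(Y, ℝ)) = c * signedIntegral s f := by
  simp only [signedIntegral, ContinuousMap.smul_apply, smul_eq_mul, integral_const_mul]
  ring

/-- The function `(x, y) ↦ f x * g y`. -/
def tensor {X : Type*} [TopologicalSpace X] (f g : C(X, ℝ)) : C(X × X, ℝ) :=
  f.comp ContinuousMap.fst * g.comp ContinuousMap.snd

lemma signedIntegral_signedProd_tensor {X : Type*} [MetricSpace X] [CompactSpace X]
    [MeasurableSpace X] [BorelSpace X] (μ : SignedMeasure X) (f g : C(X, ℝ)) :
    signedIntegral (signedProd μ μ) (tensor f g) = signedIntegral μ f * signedIntegral μ g := by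
  have hint (m : Measure (X × X)) [IsFiniteMeasure m] : Integrable (tensor f g) m :=
    integrable_continuousMap m _
  have hprod (m n : Measure X) [IsFiniteMeasure m] [IsFiniteMeasure n] :
      ∫ z, tensor f g z ∂(m.prod n) = (∫ x, f x ∂m) * ∫ x, g x ∂n :=
    integral_prod_mul _ _
  rw [signedProd, signedIntegral_toSignedMeasure_sub _ _ (hint _) (hint _),
    integral_add_measure (hint _) (hint _), integral_add_measure (hint _) (hint _)]
  simp only [hprod, signedIntegral]
  ring

lemma dense_span_tensor (X : Type*) [MetricSpace X] [CompactSpace X] :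
    Dense (Submodule.span ℝ {F : C(X × X, ℝ) | ∃ f g : C(X, ℝ), tensor f g = F} :
      Set C(X × X, ℝ)) := by
  let S : Submonoid C(X × X, ℝ) :=
    { carrier := {F | ∃ f g : C(X, ℝ), tensor f g = F}
      one_mem' := ⟨1, 1, by ext; simp [tensor]⟩
      mul_mem' := by
        rintro _ _ ⟨f, g, rfl⟩ ⟨f', g', rfl⟩
        exact ⟨f * f', g * g', by ext; simp [tensor]; ring⟩ }
  have hS : Subalgebra.toSubmodule (Algebra.adjoin ℝ (S : Set C(X × X, ℝ))) =
      Submodule.span ℝ (S : Set C(X × X, ℝ)) := by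
    rw [Algebra.adjoin_eq_span, Submonoid.closure_eq]
  have htop := ContinuousMap.subalgebra_topologicalClosure_eq_top_of_separatesPoints
    (Algebra.adjoin ℝ (S : Set C(X × X, ℝ))) <| by
      intro x y hxy
      let d (a : X) : C(X, ℝ) := ⟨fun z => dist z a, by fun_prop⟩
      by_cases h : x.1 = y.1
      · refine ⟨_, ⟨tensor 1 (d x.2), Algebra.subset_adjoin ⟨_, _, rfl⟩, rfl⟩, ?_⟩
        have h2 : y.2 ≠ x.2 := fun h2 => hxy (Prod.ext h h2.symm)
        simpa [tensor, d, eq_comm] using h2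
      · refine ⟨_, ⟨tensor (d x.1) 1, Algebra.subset_adjoin ⟨_, _, rfl⟩, rfl⟩, ?_⟩
        simpa [tensor, d, eq_comm] using h
  have hdense : Dense (Algebra.adjoin ℝ (S : Set C(X × X, ℝ)) : Set C(X × X, ℝ)) := by
    rw [dense_iff_closure_eq, ← Subalgebra.topologicalClosure_coe, htop, Algebra.coe_top]
  rwa [← Subalgebra.coe_toSubmodule, hS] at hdense

/-- **Weak-* continuity of `μ ↦ μ ⊗ μ` on balls of signed measures.**
On a compact metric space `X`, the map `μ ↦ μ ⊗ μ` is continuous from the set of finite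
signed Borel measures of total variation at most `M` (weak-* topology) to signed Borel
measures on `X × X` (weak-* topology), and it takes values in the set of signed measures
of total variation at most `M²`. -/
theorem continuousOn_signedProd
    {X : Type*} [MetricSpace X] [CompactSpace X] [MeasurableSpace X] [BorelSpace X]
    (M : ℝ) (hM : 0 < M) :
    (@ContinuousOn (SignedMeasure X) (SignedMeasure (X × X))
      (weakStarTopology X) (weakStarTopology (X × X))
      (fun μ => signedProd μ μ)
      {μ : SignedMeasure X | μ.totalVariation Set.univ ≤ ENNReal.ofReal M}) ∧
    (∀ μ : SignedMeasure X, μ.totalVariation Set.univ ≤ ENNReal.ofReal M →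
      (signedProd μ μ).totalVariation Set.univ ≤ ENNReal.ofReal (M ^ 2)) := by
  have hbound (μ : SignedMeasure X) (hμ : μ.totalVariation Set.univ ≤ ENNReal.ofReal M) :
      (signedProd μ μ).totalVariation Set.univ ≤ ENNReal.ofReal (M ^ 2) := by
    rw [ENNReal.ofReal_pow hM.le]
    exact (totalVariation_signedProd_le μ).trans (by gcongr)
  refine ⟨?_, hbound⟩
  let _ : TopologicalSpace (SignedMeasure X) := weakStarTopology X
  let _ : TopologicalSpace (SignedMeasure (X × X)) := weakStarTopology (X × X)
  set B : Set (SignedMeasure X) := {μ | μ.totalVariation Set.univ ≤ ENNReal.ofReal M}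
  have hcont (f : C(X, ℝ)) : Continuous fun μ : SignedMeasure X => signedIntegral μ f :=
    (continuous_apply f).comp (continuous_induced_dom (t := Pi.topologicalSpace)
      (f := fun (μ : SignedMeasure X) (f : C(X, ℝ)) => signedIntegral μ f))
  have hspan (F : C(X × X, ℝ))
      (hF : F ∈ Submodule.span ℝ {F : C(X × X, ℝ) | ∃ f g : C(X, ℝ), tensor f g = F}) :
      Continuous fun μ : SignedMeasure X => signedIntegral (signedProd μ μ) F := by
    induction hF using Submodule.span_induction with
    | mem F hF =>
      obtain ⟨f, g, rfl⟩ := hF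
      simp only [signedIntegral_signedProd_tensor]
      exact (hcont f).mul (hcont g)
    | zero => simpa [signedIntegral] using! continuous_const
    | add F G _ _ hF hG => simpa only [signedIntegral_add] using! hF.add hG
    | smul c F _ hF => simpa only [signedIntegral_smul] using hF.const_mul c
  have hall (F : C(X × X, ℝ)) :
      ContinuousOn (fun μ : SignedMeasure X => signedIntegral (signedProd μ μ) F) B := by
    refine continuousOn_of_uniform_approx_of_continuousOn fun u hu => ?_
    obtain ⟨ε, hε, hεu⟩ := Metric.mem_uniformity_dist.1 hu
    obtain ⟨G, hG, hFG⟩ := (dense_span_tensor X).exists_dist_lt F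
      (div_pos hε (pow_pos hM 2))
    refine ⟨_, (hspan G hG).continuousOn, fun μ hμ => hεu ?_⟩
    have hsub : signedIntegral (signedProd μ μ) F =
        signedIntegral (signedProd μ μ) (F - G : C(X × X, ℝ)) +
          signedIntegral (signedProd μ μ) G := by
      rw [← signedIntegral_add, sub_add_cancel]
    rw [Real.dist_eq, hsub, add_sub_cancel_right]
    calc _ ≤ ‖F - G‖ * ((signedProd μ μ).totalVariation Set.univ).toReal :=
          abs_signedIntegral_le _ _
      _ ≤ ‖F - G‖ * M ^ 2 := by
          gcongr
          exact ENNReal.toReal_le_of_le_ofReal (sq_nonneg M) (hbound μ hμ)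
      _ < ε := by rwa [← dist_eq_norm, ← lt_div_iff₀ (pow_pos hM 2)]
  rw [continuousOn_iff_continuous_domRestrict]
  refine continuous_induced_rng.2 (continuous_pi fun F => ?_)
  exact (hall F).domRestrict

end
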